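/- Let n ≥ 2, W a real n²×n² matrix, c ∈ ℝ^{n²}, f(x) = xᵀWx + cᵀx. Let Φ map a binary (n−1)×(n−1) matrix Y (indexed by i,j ∈ {2,…,n}) to the n×n matrix X with X_{i,j} = Y_{i,j} for i,j ≥ 2, X_{1,j} = 1 − Σ_{i=2}^n Y_{i,j} for j ≥ 2, X_{i,1} = 1 − Σ_{j=2}^n Y_{i,j} for i ≥ 2, and X_{1,1} = 2 − n + Σ_{i,j=2}^n Y_{i,j}. Then there exists Λ ≥ 0 such that for all λ₁, λ₂ ≥ Λ: the minimum of f(vec X) over n×n permutation matrices X equals the minimum over all binary Y ∈ {0,1}^{(n−1)×(n−1)} of f(vec Φ(Y)) + λ₁ Σ Y_{i,j} Y_{k,l} (the sum over all ordered pairs of distinct index pairs (i,j) ≠ (k,l) with i = k or j = l) + λ₂ (Σ_{i,j} Y_{i,j} − (n−1)) (Σ_{i,j} Y_{i,j} − (n−2)), and every minimizer Y of the latter problem satisfies that Φ(Y) is a permutation matrix minimizing f over vectorized permutation matrices. -/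

import Mathlib

/-- `X` is a permutation matrix: binary entries, all row sums and column sums equal 1. -/
def IsPermMat {n : ℕ} (X : Matrix (Fin n) (Fin n) ℝ) : Prop :=
  (∀ i j, X i j = 0 ∨ X i j = 1) ∧ (∀ i, ∑ j, X i j = 1) ∧ (∀ j, ∑ i, X i j = 1)

/-- Vectorization of an `n×n` matrix, as a function on index pairs. -/
def vec {n : ℕ} (X : Matrix (Fin n) (Fin n) ℝ) : (Fin n × Fin n) → ℝ :=
  fun p => X p.1 p.2

/-- The map `Φ` completing a binary `(n−1)×(n−1)` matrix `Y` (indexed by `{2,…,n}²`)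
to an `n×n` matrix: `X_{i,j} = Y_{i,j}` for `i,j ≥ 2`, `X_{1,j} = 1 − Σ_{i≥2} Y_{i,j}`,
`X_{i,1} = 1 − Σ_{j≥2} Y_{i,j}`, and `X_{1,1} = 2 − n + Σ_{i,j≥2} Y_{i,j}`. -/
noncomputable def Phi (n : ℕ) (Y : Matrix (Fin (n - 1)) (Fin (n - 1)) ℝ) :
    Matrix (Fin n) (Fin n) ℝ := fun i j =>
  if hi : i.val = 0 then
    if hj : j.val = 0 then 2 - (n : ℝ) + ∑ a, ∑ b, Y a b
    else 1 - ∑ a, Y a ⟨j.val - 1, by omega⟩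
  else
    if hj : j.val = 0 then 1 - ∑ b, Y ⟨i.val - 1, by omega⟩ b
    else Y ⟨i.val - 1, by omega⟩ ⟨j.val - 1, by omega⟩

/-- The quadratic penalty `Σ Y_{i,j} Y_{k,l}` over all ordered pairs of distinct index
pairs `(i,j) ≠ (k,l)` with `i = k` or `j = l`. -/
def pen1 {n : ℕ} (Y : Matrix (Fin (n - 1)) (Fin (n - 1)) ℝ) : ℝ :=
  ∑ p : Fin (n - 1) × Fin (n - 1), ∑ q : Fin (n - 1) × Fin (n - 1),
    if p ≠ q ∧ (p.1 = q.1 ∨ p.2 = q.2) then Y p.1 p.2 * Y q.1 q.2 else 0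

/-- The penalty `(Σ Y_{i,j} − (n−1)) (Σ Y_{i,j} − (n−2))`. -/
def pen2 (n : ℕ) (Y : Matrix (Fin (n - 1)) (Fin (n - 1)) ℝ) : ℝ :=
  ((∑ i, ∑ j, Y i j) - ((n : ℝ) - 1)) * ((∑ i, ∑ j, Y i j) - ((n : ℝ) - 2))

/-- A binary vector whose entries are pairwise orthogonal has at most one nonzero entry. -/
theorem sum_eq_zero_or_one_of_pairwise_mul_eq_zero {ι : Type*} [Fintype ι] {v : ι → ℝ}
    (hv : ∀ i, v i = 0 ∨ v i = 1) (h : ∀ i j, i ≠ j → v i * v j = 0) :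
    ∑ i, v i = 0 ∨ ∑ i, v i = 1 := by
  by_cases hex : ∃ i, v i = 1
  · obtain ⟨i, hi⟩ := hex
    right
    rw [Finset.sum_eq_single i _ (by simp), hi]
    intro j _ hj
    simpa [hi] using h j i hj
  · push Not at hex
    exact Or.inl (Finset.sum_eq_zero fun i _ => (hv i).resolve_right (hex i))

theorem mul_eq_zero_of_sum_eq_one {ι : Type*} [Fintype ι] {v : ι → ℝ}
    (hv : ∀ i, v i = 0 ∨ v i = 1) (h : ∑ i, v i = 1) {i j : ι} (hij : i ≠ j) :
    v i * v j = 0 := by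
  classical
  have hle : ∑ k ∈ {i, j}, v k ≤ ∑ k, v k :=
    Finset.sum_le_univ_sum_of_nonneg fun k => by rcases hv k with hk | hk <;> simp [hk]
  rw [Finset.sum_pair hij, h] at hle
  rcases hv i with hi | hi
  · simp [hi]
  · rcases hv j with hj | hj
    · simp [hj]
    · rw [hi, hj] at hle
      norm_num at hle

theorem exists_nat_sum_eq {ι : Type*} (s : Finset ι) {v : ι → ℝ}
    (hv : ∀ i, ∃ k : ℕ, v i = k) : ∃ k : ℕ, ∑ i ∈ s, v i = k := by
  choose k hk using hv
  exact ⟨∑ i ∈ s, k i, by simp [hk]⟩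

theorem exists_nat_eq_of_binary {x : ℝ} (h : x = 0 ∨ x = 1) : ∃ k : ℕ, x = k := by
  rcases h with h | h
  · exact ⟨0, by simp [h]⟩
  · exact ⟨1, by simp [h]⟩

section Penalties

variable {m : ℕ} {Y : Matrix (Fin m) (Fin m) ℝ}

theorem pen1_exists_nat (hY : ∀ i j, Y i j = 0 ∨ Y i j = 1) :
    ∃ k : ℕ, pen1 (n := m + 1) Y = k := by
  refine exists_nat_sum_eq _ fun p => exists_nat_sum_eq _ fun q => exists_nat_eq_of_binary ?_
  split_ifs
  · rcases hY p.1 p.2 with h | h <;> rcases hY q.1 q.2 with h' | h' <;> simp [h, h']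
  · simp

theorem pen1_eq_zero_iff (hY : ∀ i j, Y i j = 0 ∨ Y i j = 1) :
    pen1 (n := m + 1) Y = 0 ↔
      (∀ i j l, j ≠ l → Y i j * Y i l = 0) ∧ (∀ j i k, i ≠ k → Y i j * Y k j = 0) := by
  have h0 : ∀ i j, 0 ≤ Y i j := fun i j => by rcases hY i j with h | h <;> simp [h]
  have hterm : ∀ p q : Fin m × Fin m,
      0 ≤ if p ≠ q ∧ (p.1 = q.1 ∨ p.2 = q.2) then Y p.1 p.2 * Y q.1 q.2 else 0 := by
    intro p q
    split_ifs
    · exact mul_nonneg (h0 _ _) (h0 _ _)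
    · exact le_rfl
  constructor
  · intro h
    have key : ∀ p q : Fin m × Fin m, p ≠ q → (p.1 = q.1 ∨ p.2 = q.2) →
        Y p.1 p.2 * Y q.1 q.2 = 0 := by
      intro p q hpq hor
      have h1 := (Finset.sum_eq_zero_iff_of_nonneg
        (fun p _ => Finset.sum_nonneg fun q _ => hterm p q)).1 h p (Finset.mem_univ _)
      have h2 := (Finset.sum_eq_zero_iff_of_nonneg (fun q _ => hterm p q)).1 h1 q
        (Finset.mem_univ _)
      rwa [if_pos ⟨hpq, hor⟩] at h2
    exact ⟨fun i j l hjl => key (i, j) (i, l) (by simpa using hjl) (Or.inl rfl),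
      fun j i k hik => key (i, j) (k, j) (by simpa using hik) (Or.inr rfl)⟩
  · rintro ⟨hrow, hcol⟩
    refine Finset.sum_eq_zero fun p _ => Finset.sum_eq_zero fun q _ => ?_
    obtain ⟨i, j⟩ := p
    obtain ⟨k, l⟩ := q
    split_ifs with h
    · obtain ⟨hne, h | h⟩ := h
      · obtain rfl : i = k := h
        exact hrow i j l fun hjl => hne (by rw [hjl])
      · obtain rfl : j = l := h
        exact hcol j i k fun hik => hne (by rw [hik])
    · rfl

theorem sum_exists_nat (hY : ∀ i j, Y i j = 0 ∨ Y i j = 1) : ∃ k : ℕ, ∑ i, ∑ j, Y i j = k :=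
  exists_nat_sum_eq _ fun i => exists_nat_sum_eq _ fun j => exists_nat_eq_of_binary (hY i j)

theorem pen2_exists_nat (hY : ∀ i j, Y i j = 0 ∨ Y i j = 1) :
    ∃ k : ℕ, pen2 (m + 1) Y = k := by
  obtain ⟨s, hs⟩ := sum_exists_nat hY
  have hpen : pen2 (m + 1) Y = (((s : ℤ) - m) * ((s : ℤ) - m + 1) : ℤ) := by
    change ((∑ i : Fin m, ∑ j : Fin m, Y i j) - _) * ((∑ i : Fin m, ∑ j : Fin m, Y i j) - _) = _
    rw [hs]
    push_cast
    ring
  have hnonneg : 0 ≤ ((s : ℤ) - m) * ((s : ℤ) - m + 1) := by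
    rcases le_or_gt 0 ((s : ℤ) - m) with h | h
    · positivity
    · exact mul_nonneg_of_nonpos_of_nonpos (by omega) (by omega)
  obtain ⟨k, hk⟩ := Int.eq_ofNat_of_zero_le hnonneg
  exact ⟨k, by rw [hpen, hk]; simp⟩

theorem pen2_eq_zero_iff :
    pen2 (m + 1) Y = 0 ↔
      Phi (m + 1) Y 0 0 = 0 ∨ Phi (m + 1) Y 0 0 = 1 := by
  change ((∑ i : Fin m, ∑ j : Fin m, Y i j) - _) * ((∑ i : Fin m, ∑ j : Fin m, Y i j) - _) = 0 ↔
    2 - ((m + 1 : ℕ) : ℝ) + (∑ i : Fin m, ∑ j : Fin m, Y i j) = 0 ∨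
    2 - ((m + 1 : ℕ) : ℝ) + (∑ i : Fin m, ∑ j : Fin m, Y i j) = 1
  rw [mul_eq_zero, or_comm]
  refine or_congr ⟨fun h => ?_, fun h => ?_⟩ ⟨fun h => ?_, fun h => ?_⟩ <;> linarith

end Penalties

section Completion

variable {m : ℕ} (Y : Matrix (Fin m) (Fin m) ℝ)

theorem Phi_zero_zero : Phi (m + 1) Y 0 0 = 1 - m + ∑ i, ∑ j, Y i j := by
  change 2 - ((m + 1 : ℕ) : ℝ) + (∑ i : Fin m, ∑ j : Fin m, Y i j) = _
  push_cast
  ring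

theorem Phi_zero_succ (j : Fin m) : Phi (m + 1) Y 0 j.succ = 1 - ∑ i, Y i j := rfl

theorem Phi_succ_zero (i : Fin m) : Phi (m + 1) Y i.succ 0 = 1 - ∑ j, Y i j := rfl

theorem Phi_succ_succ (i j : Fin m) : Phi (m + 1) Y i.succ j.succ = Y i j := rfl

theorem Phi_row_sum (i : Fin (m + 1)) : ∑ j, Phi (m + 1) Y i j = 1 := by
  rw [Fin.sum_univ_succ]
  refine Fin.cases ?_ (fun i => ?_) i
  · simp only [Phi_zero_zero, Phi_zero_succ, Finset.sum_sub_distrib]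
    rw [Finset.sum_comm]
    simp
  · simp only [Phi_succ_zero, Phi_succ_succ]
    ring

theorem Phi_col_sum (j : Fin (m + 1)) : ∑ i, Phi (m + 1) Y i j = 1 := by
  rw [Fin.sum_univ_succ]
  refine Fin.cases ?_ (fun j => ?_) j
  · simp only [Phi_zero_zero, Phi_succ_zero, Finset.sum_sub_distrib]
    simp
  · simp only [Phi_zero_succ, Phi_succ_succ]
    ring

/-- A matrix with unit row and column sums is the completion of its lower right block. -/
theorem Phi_submatrix_succ {X : Matrix (Fin (m + 1)) (Fin (m + 1)) ℝ}
    (hrow : ∀ i, ∑ j, X i j = 1) (hcol : ∀ j, ∑ i, X i j = 1) :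
    Phi (m + 1) (X.submatrix Fin.succ Fin.succ) = X := by
  simp only [Fin.sum_univ_succ (n := m)] at hrow hcol
  have hsum : ∑ i : Fin m, ∑ j : Fin m, X i.succ j.succ = m - ∑ i : Fin m, X i.succ 0 := by
    simp only [fun i : Fin m => eq_sub_of_add_eq' (hrow i.succ), Finset.sum_sub_distrib]
    simp
  ext i j
  refine Fin.cases (Fin.cases ?_ (fun j => ?_) j) (fun i => Fin.cases ?_ (fun j => ?_) j) i
  · simp only [Phi_zero_zero, Matrix.submatrix_apply, hsum]
    linarith [hcol 0]
  · simp only [Phi_zero_succ, Matrix.submatrix_apply]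
    linarith [hcol j.succ]
  · simp only [Phi_succ_zero, Matrix.submatrix_apply]
    linarith [hrow i.succ]
  · rfl

variable {Y}

theorem isPermMat_Phi (hY : ∀ i j, Y i j = 0 ∨ Y i j = 1)
    (h1 : pen1 (n := m + 1) Y = 0) (h2 : pen2 (m + 1) Y = 0) : IsPermMat (Phi (m + 1) Y) := by
  obtain ⟨hr, hc⟩ := (pen1_eq_zero_iff hY).1 h1
  refine ⟨fun i j => ?_, Phi_row_sum Y, Phi_col_sum Y⟩
  refine Fin.cases (Fin.cases ?_ (fun j => ?_) j) (fun i => Fin.cases ?_ (fun j => ?_) j) i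
  · exact pen2_eq_zero_iff.1 h2
  · rw [Phi_zero_succ]
    rcases sum_eq_zero_or_one_of_pairwise_mul_eq_zero (fun i => hY i j) (hc j) with h | h <;>
      simp [h]
  · rw [Phi_succ_zero]
    rcases sum_eq_zero_or_one_of_pairwise_mul_eq_zero (hY i) (hr i) with h | h <;> simp [h]
  · exact hY i j

theorem IsPermMat.exists_Phi_eq {X : Matrix (Fin (m + 1)) (Fin (m + 1)) ℝ} (hX : IsPermMat X) :
    ∃ Y : Matrix (Fin m) (Fin m) ℝ, (∀ i j, Y i j = 0 ∨ Y i j = 1) ∧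
      Phi (m + 1) Y = X ∧ pen1 (n := m + 1) Y = 0 ∧ pen2 (m + 1) Y = 0 := by
  obtain ⟨hbin, hrow, hcol⟩ := hX
  have hPhi := Phi_submatrix_succ hrow hcol
  refine ⟨X.submatrix Fin.succ Fin.succ, fun i j => hbin _ _, hPhi, ?_, ?_⟩
  · exact (pen1_eq_zero_iff (Y := X.submatrix Fin.succ Fin.succ) fun i j => hbin _ _).2
      ⟨fun i j l hjl => mul_eq_zero_of_sum_eq_one (hbin i.succ) (hrow _)
        ((Fin.succ_injective _).ne hjl),
      fun j i k hik => mul_eq_zero_of_sum_eq_one (fun i => hbin i j.succ) (hcol _)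
        ((Fin.succ_injective _).ne hik)⟩
  · rw [pen2_eq_zero_iff, hPhi]
    exact hbin 0 0

end Completion

theorem isPermMat_one {n : ℕ} : IsPermMat (1 : Matrix (Fin n) (Fin n) ℝ) :=
  ⟨fun i j => by rw [Matrix.one_apply]; split_ifs <;> simp,
    fun i => by simp [Matrix.one_apply], fun j => by simp [Matrix.one_apply]⟩

theorem finite_binary_matrices (m : ℕ) :
    {Y : Matrix (Fin m) (Fin m) ℝ | ∀ i j, Y i j = 0 ∨ Y i j = 1}.Finite :=
  Set.Finite.pi' fun _ => Set.Finite.pi' fun _ => Set.toFinite {0, 1}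

/-- Inserted formulation with eliminated variables: there exists `Λ ≥ 0` such that for
all `λ₁, λ₂ ≥ Λ`, the minimum of `f(vec X) = (vec X)ᵀ W (vec X) + cᵀ vec X` over `n×n`
permutation matrices `X` equals the minimum over binary `(n−1)×(n−1)` matrices `Y` of
`f(vec Φ(Y)) + λ₁ pen1(Y) + λ₂ pen2(Y)`, and every minimizer `Y` of the latter yields a
permutation matrix `Φ(Y)` minimizing `f` over vectorized permutation matrices. -/
theorem stmt_3 (n : ℕ) (hn : 2 ≤ n)
    (W : Matrix (Fin n × Fin n) (Fin n × Fin n) ℝ) (c : (Fin n × Fin n) → ℝ)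
    (f : ((Fin n × Fin n) → ℝ) → ℝ)
    (hf : ∀ x, f x = (∑ p, ∑ q, x p * W p q * x q) + ∑ p, c p * x p) :
    ∃ Λ : ℝ, 0 ≤ Λ ∧ ∀ lam1 lam2 : ℝ, Λ ≤ lam1 → Λ ≤ lam2 →
      (∀ μ : ℝ,
        IsLeast {v : ℝ | ∃ X : Matrix (Fin n) (Fin n) ℝ,
            IsPermMat X ∧ v = f (vec X)} μ ↔
        IsLeast {v : ℝ | ∃ Y : Matrix (Fin (n - 1)) (Fin (n - 1)) ℝ,
            (∀ i j, Y i j = 0 ∨ Y i j = 1) ∧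
            v = f (vec (Phi n Y)) + lam1 * pen1 Y + lam2 * pen2 n Y} μ) ∧
      (∀ Y : Matrix (Fin (n - 1)) (Fin (n - 1)) ℝ, (∀ i j, Y i j = 0 ∨ Y i j = 1) →
        (∀ Z : Matrix (Fin (n - 1)) (Fin (n - 1)) ℝ, (∀ i j, Z i j = 0 ∨ Z i j = 1) →
          f (vec (Phi n Y)) + lam1 * pen1 Y + lam2 * pen2 n Y ≤
            f (vec (Phi n Z)) + lam1 * pen1 Z + lam2 * pen2 n Z) →
        IsPermMat (Phi n Y) ∧
          ∀ X : Matrix (Fin n) (Fin n) ℝ, IsPermMat X →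
            f (vec (Phi n Y)) ≤ f (vec X)) := by
  obtain ⟨m, rfl⟩ : ∃ m, n = m + 1 := ⟨n - 1, by omega⟩
  obtain ⟨B, hB⟩ := ((finite_binary_matrices m).image
    fun Y => |f (vec (Phi (m + 1) Y))|).bddAbove
  replace hB : ∀ Y : Matrix (Fin m) (Fin m) ℝ, (∀ i j, Y i j = 0 ∨ Y i j = 1) →
      |f (vec (Phi (m + 1) Y))| ≤ B := fun Y hY => hB ⟨Y, hY, rfl⟩
  have hB0 : 0 ≤ B := by
    obtain ⟨Y, hY, -⟩ := (isPermMat_one (n := m + 1)).exists_Phi_eq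
    exact (abs_nonneg _).trans (hB Y hY)
  refine ⟨2 * B + 1, by positivity, fun lam1 lam2 h1 h2 => ?_⟩
  have hperm : ∀ X : Matrix (Fin (m + 1)) (Fin (m + 1)) ℝ, IsPermMat X →
      f (vec X) ≤ B ∧ ∃ Y : Matrix (Fin m) (Fin m) ℝ, (∀ i j, Y i j = 0 ∨ Y i j = 1) ∧
        f (vec (Phi (m + 1) Y)) + lam1 * pen1 (n := m + 1) Y + lam2 * pen2 (m + 1) Y
          = f (vec X) := by
    intro X hX
    obtain ⟨Y, hY, rfl, hp1, hp2⟩ := hX.exists_Phi_eq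
    exact ⟨(abs_le.1 (hB Y hY)).2, Y, hY, by rw [hp1, hp2]; ring⟩
  have hbin : ∀ Y : Matrix (Fin m) (Fin m) ℝ, (∀ i j, Y i j = 0 ∨ Y i j = 1) →
      (IsPermMat (Phi (m + 1) Y) ∧
        f (vec (Phi (m + 1) Y)) + lam1 * pen1 (n := m + 1) Y + lam2 * pen2 (m + 1) Y
          = f (vec (Phi (m + 1) Y))) ∨
      B < f (vec (Phi (m + 1) Y)) + lam1 * pen1 (n := m + 1) Y + lam2 * pen2 (m + 1) Y := by
    intro Y hY
    obtain ⟨k, hk⟩ := pen1_exists_nat hY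
    obtain ⟨l, hl⟩ := pen2_exists_nat hY
    by_cases h0 : k = 0 ∧ l = 0
    · obtain ⟨rfl, rfl⟩ := h0
      rw [Nat.cast_zero] at hk hl
      exact Or.inl ⟨isPermMat_Phi hY hk hl, by rw [hk, hl]; ring⟩
    · right
      have hkl : (1 : ℝ) ≤ k + l := by exact_mod_cast (by omega : 1 ≤ k + l)
      have hlow := (abs_le.1 (hB Y hY)).1
      rw [hk, hl]
      nlinarith [mul_le_mul_of_nonneg_right h1 (Nat.cast_nonneg (α := ℝ) k),
        mul_le_mul_of_nonneg_right h2 (Nat.cast_nonneg (α := ℝ) l)]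
  refine ⟨fun μ => ⟨?_, ?_⟩, fun Y hY hmin => ?_⟩
  · rintro ⟨⟨X, hX, rfl⟩, hlow⟩
    obtain ⟨hXB, Y, hY, hYX⟩ := hperm X hX
    refine ⟨⟨Y, hY, hYX.symm⟩, ?_⟩
    rintro _ ⟨Z, hZ, rfl⟩
    rcases hbin Z hZ with ⟨hZp, hZe⟩ | hZ
    · exact (hlow ⟨_, hZp, rfl⟩).trans_eq hZe.symm
    · exact hXB.trans hZ.le
  · rintro ⟨⟨Y, hY, rfl⟩, hlow⟩
    have hle : ∀ X : Matrix (Fin (m + 1)) (Fin (m + 1)) ℝ, IsPermMat X →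
        f (vec (Phi (m + 1) Y)) + lam1 * pen1 (n := m + 1) Y + lam2 * pen2 (m + 1) Y
          ≤ f (vec X) := by
      intro X hX
      obtain ⟨-, Z, hZ, hZX⟩ := hperm X hX
      exact hlow ⟨Z, hZ, hZX.symm⟩
    refine ⟨?_, ?_⟩
    · rcases hbin Y hY with ⟨hYp, hYe⟩ | hlt
      · exact ⟨_, hYp, hYe⟩
      · exact absurd ((hle 1 isPermMat_one).trans (hperm 1 isPermMat_one).1) hlt.not_ge
    · rintro _ ⟨X, hX, rfl⟩
      exact hle X hX
  · have hle : ∀ X : Matrix (Fin (m + 1)) (Fin (m + 1)) ℝ, IsPermMat X →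
        f (vec (Phi (m + 1) Y)) + lam1 * pen1 (n := m + 1) Y + lam2 * pen2 (m + 1) Y
          ≤ f (vec X) := by
      intro X hX
      obtain ⟨-, Z, hZ, hZX⟩ := hperm X hX
      exact (hmin Z hZ).trans_eq hZX
    rcases hbin Y hY with ⟨hYp, hYe⟩ | hlt
    · exact ⟨hYp, fun X hX => hYe.symm.trans_le (hle X hX)⟩
    · exact absurd ((hle 1 isPermMat_one).trans (hperm 1 isPermMat_one).1) hlt.not_ge
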